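/- arXiv:2605.16620 — 2 statements merged into one kernel-verified Lean document; each statement's English description precedes it below -/
import Mathlib

section
/- Let (a_m)_{m≥1} be a sequence of real numbers with ∑_{m=1}^∞ |a_m| < ∞, and let N be a random variable taking values in the natural numbers such that P(N ≥ m) > 0 for every m ≥ 1. Then the random variable ∑_{m=1}^{N} a_m / P(N ≥ m) is integrable and E_N[ ∑_{m=1}^{N} a_m / P(N ≥ m) ] = ∑_{m=1}^∞ a_m. -/
open MeasureTheory

/-- A measurable pointwise sum of a series of integrable functions whose `L¹` norms are summable is
integrable. -/
theorem integrable_tsum_of_summable_integral_norm {α ι E : Type*} [MeasurableSpace α]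
    {μ : Measure α} [Countable ι] [NormedAddCommGroup E] {F : ι → α → E}
    (hF_int : ∀ i, Integrable (F i) μ) (hF_sum : Summable fun i => ∫ x, ‖F i x‖ ∂μ)
    (hF_meas : AEStronglyMeasurable (fun x => ∑' i, F i x) μ) :
    Integrable (fun x => ∑' i, F i x) μ := by
  refine ⟨hF_meas, ?_⟩
  calc ∫⁻ x, ‖∑' i, F i x‖ₑ ∂μ
      ≤ ∫⁻ x, ∑' i, ‖F i x‖ₑ ∂μ := lintegral_mono fun x => enorm_tsum_le_tsum_enorm
    _ = ∑' i, ∫⁻ x, ‖F i x‖ₑ ∂μ := lintegral_tsum fun i => (hF_int i).1.enorm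
    _ = ∑' i, ENNReal.ofReal (∫ x, ‖F i x‖ ∂μ) := by
      simp_rw [ofReal_integral_norm_eq_lintegral_enorm (hF_int _)]
    _ < ⊤ := hF_sum.tsum_ofReal_lt_top

/-- A finite sum over `1, …, n` as a series of indicators of the events `m + 1 ≤ n`. -/
theorem sum_Icc_one_eq_tsum_indicator {Ω : Type*} (N : Ω → ℕ) (b : ℕ → ℝ) (ω : Ω) :
    ∑ m ∈ Finset.Icc 1 (N ω), b m
      = ∑' m : ℕ, {ω' | m + 1 ≤ N ω'}.indicator (fun _ => b (m + 1)) ω := by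
  rw [tsum_eq_sum (s := Finset.range (N ω))]
  · rw [← Finset.Ico_succ_right_eq_Icc, Finset.sum_Ico_eq_sum_range]
    refine Finset.sum_congr (by simp) fun m hm => ?_
    have hm' : ω ∈ {ω' | m + 1 ≤ N ω'} := by simpa using hm
    rw [Set.indicator_of_mem hm', add_comm]
  · intro m hm
    have hm' : ω ∉ {ω' | m + 1 ≤ N ω'} := by simpa using hm
    exact Set.indicator_of_notMem hm' _

/-- **Russian-roulette estimator.** If `(a_m)_{m ≥ 1}` is absolutely summable and
`N` is an ℕ-valued random variable with `P(N ≥ m) > 0` for all `m ≥ 1`, then the randomly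
truncated, reweighted sum `∑_{m=1}^{N} a_m / P(N ≥ m)` is integrable and its expectation equals
`∑_{m=1}^∞ a_m`. -/
theorem russian_roulette_unbiased {Ω : Type*} [MeasurableSpace Ω]
    (P : Measure Ω) [IsProbabilityMeasure P]
    (N : Ω → ℕ) (hN : Measurable N)
    (a : ℕ → ℝ) (ha : Summable fun m : ℕ => |a m|)
    (hpos : ∀ m : ℕ, 1 ≤ m → 0 < (P {ω | m ≤ N ω}).toReal) :
    Integrable
      (fun ω => ∑ m ∈ Finset.Icc 1 (N ω), a m / (P {ω' | m ≤ N ω'}).toReal) P ∧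
    ∫ ω, (∑ m ∈ Finset.Icc 1 (N ω), a m / (P {ω' | m ≤ N ω'}).toReal) ∂P
      = ∑' m : ℕ, a (m + 1) := by
  have hmeas : ∀ m : ℕ, MeasurableSet {ω | m + 1 ≤ N ω} := fun m => hN measurableSet_Ici
  set b : ℕ → ℝ := fun m => a m / (P {ω' | m ≤ N ω'}).toReal with hb
  let F : ℕ → Ω → ℝ := fun m => {ω | m + 1 ≤ N ω}.indicator fun _ => b (m + 1)
  have hF_int : ∀ m, Integrable (F m) P := fun m => (integrable_const _).indicator (hmeas m)
  have hF_integral : ∀ m, ∫ ω, F m ω ∂P = a (m + 1) := fun m => by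
    rw [integral_indicator_const _ (hmeas m), smul_eq_mul]
    exact mul_div_cancel₀ _ (hpos (m + 1) (Nat.le_add_left 1 m)).ne'
  have hF_norm : ∀ m, ∫ ω, ‖F m ω‖ ∂P = |a (m + 1)| := fun m => by
    simp only [F, norm_indicator_eq_indicator_norm]
    rw [integral_indicator_const _ (hmeas m), smul_eq_mul, hb, Real.norm_eq_abs, abs_div,
      abs_of_pos (hpos (m + 1) (Nat.le_add_left 1 m))]
    exact mul_div_cancel₀ _ (hpos (m + 1) (Nat.le_add_left 1 m)).ne'
  have hF_sum : Summable fun m => ∫ ω, ‖F m ω‖ ∂P := by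
    simpa only [hF_norm] using (summable_nat_add_iff 1).2 ha
  have hsum : (fun ω => ∑ m ∈ Finset.Icc 1 (N ω), b m) = fun ω => ∑' m, F m ω :=
    funext (sum_Icc_one_eq_tsum_indicator N b)
  have hsum_meas : Measurable fun ω => ∑ m ∈ Finset.Icc 1 (N ω), b m :=
    (measurable_from_top (f := fun n : ℕ => ∑ m ∈ Finset.Icc 1 n, b m)).comp hN
  change Integrable (fun ω => ∑ m ∈ Finset.Icc 1 (N ω), b m) P ∧
    ∫ ω, (fun ω => ∑ m ∈ Finset.Icc 1 (N ω), b m) ω ∂P = _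
  rw [hsum] at hsum_meas ⊢
  refine ⟨integrable_tsum_of_summable_integral_norm hF_int hF_sum
    hsum_meas.aestronglyMeasurable, ?_⟩
  rw [← integral_tsum_of_summable_integral_norm hF_int hF_sum]
  simp only [hF_integral]
end

section
/- Let J be a real d×d matrix whose Euclidean operator norm satisfies ‖J‖ < 1. Let w be a random vector in ℝ^d with independent standard Gaussian N(0,1) coordinates, and let N be a random variable taking values in the natural numbers, independent of w, with P(N ≥ m) > 0 for every m ≥ 1. Then E_{N,w}[ ∑_{m=1}^{N} (wᵀ Jᵐ w) / (m · P(N ≥ m)) ] = − log det(I − J), where the expectation is taken with respect to the product of the law of N and the product Gaussian measure on ℝ^d. -/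
open MeasureTheory ProbabilityTheory Matrix

section LogDet

open scoped Matrix.Norms.L2Operator

variable {n : Type*} [Fintype n] [DecidableEq n]

theorem Matrix.exists_abs_trace_le_mul_l2_opNorm :
    ∃ C : ℝ, 0 ≤ C ∧ ∀ A : Matrix n n ℝ, |A.trace| ≤ C * ‖A‖ := by
  let T := LinearMap.toContinuousLinearMap (Matrix.traceLinearMap n ℝ ℝ)
  exact ⟨‖T‖, norm_nonneg T, fun A => T.le_opNorm A⟩

theorem Matrix.hasDerivAt_det_one_add_smul (M : Matrix n n ℝ) :
    HasDerivAt (fun s : ℝ => (1 + s • M).det) M.trace 0 := by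
  rw [funext fun s : ℝ => Matrix.det_one_add_smul s M]
  set p := (1 + (Polynomial.X : Polynomial ℝ) • M.map Polynomial.C).det.divX.divX
  have h := (((hasDerivAt_id (0 : ℝ)).const_mul M.trace).const_add 1).add
    ((p.hasDerivAt 0).mul (hasDerivAt_pow 2 (0 : ℝ)))
  exact h.congr_deriv (by simp)

theorem Matrix.hasDerivAt_det_one_sub_smul (J : Matrix n n ℝ) {t : ℝ} {R : Matrix n n ℝ}
    (hR : (1 - t • J) * R = 1) :
    HasDerivAt (fun s : ℝ => (1 - s • J).det) (-((1 - t • J).det * (R * J).trace)) t := by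
  have hdet : (fun s : ℝ => (1 - s • J).det) =
      fun s => (1 - t • J).det * (1 + (s - t) • (-(R * J))).det := by
    funext s
    rw [← Matrix.det_mul]
    congr 1
    rw [mul_add, mul_one, mul_smul_comm, mul_neg, ← mul_assoc, hR, one_mul, sub_smul]
    simp only [smul_neg]
    abel
  rw [hdet]
  have h := Matrix.hasDerivAt_det_one_add_smul (-(R * J))
  rw [← sub_self t] at h
  simpa [mul_comm] using (h.comp_sub_const t t).const_mul (1 - t • J).det

theorem Matrix.hasSum_trace_pow_div (J : Matrix n n ℝ) (hJ : ‖J‖ < 1) :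
    HasSum (fun m : ℕ => (J ^ (m + 1)).trace / ((m : ℝ) + 1)) (-Real.log (1 - J).det) := by
  obtain ⟨C, hC, htr⟩ := Matrix.exists_abs_trace_le_mul_l2_opNorm (n := n)
  set r := ‖J‖ with hr
  have hr0 : 0 ≤ r := norm_nonneg J
  set ρ : ℝ := 2 / (1 + r) with hρ
  have hρ1 : 1 < ρ := by rw [hρ, lt_div_iff₀ (by positivity)]; linarith
  have hrρ : r * ρ < 1 := by
    rw [hρ, ← mul_div_assoc, div_lt_one (by positivity)]; linarith
  have hpow (m : ℕ) : |(J ^ (m + 1)).trace| ≤ C * r ^ (m + 1) :=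
    (htr _).trans (by gcongr; exact norm_pow_le' J m.succ_pos)
  let g : ℕ → ℝ → ℝ := fun m t => t ^ (m + 1) * ((J ^ (m + 1)).trace / ((m : ℝ) + 1))
  let S : ℝ → ℝ := fun t => ∑' m, g m t
  have hu : Summable fun m : ℕ => C * r * (r * ρ) ^ m :=
    (summable_geometric_of_lt_one (by positivity) hrρ).mul_left _
  have hg (m : ℕ) (t : ℝ) : HasDerivAt (g m) (t ^ m * (J ^ (m + 1)).trace) t := by
    have h := (hasDerivAt_pow (m + 1) t).mul_const ((J ^ (m + 1)).trace / ((m : ℝ) + 1))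
    refine h.congr_deriv ?_
    have : (m : ℝ) + 1 ≠ 0 := by positivity
    push_cast
    field_simp
  have hbound (m : ℕ) (t : ℝ) (ht : t ∈ Metric.ball (0 : ℝ) ρ) :
      ‖t ^ m * (J ^ (m + 1)).trace‖ ≤ C * r * (r * ρ) ^ m := by
    have ht' : |t| ≤ ρ := by simpa using (Metric.mem_ball.mp ht).le
    rw [norm_mul, norm_pow, Real.norm_eq_abs, Real.norm_eq_abs]
    calc |t| ^ m * |(J ^ (m + 1)).trace| ≤ ρ ^ m * (C * r ^ (m + 1)) := by
          gcongr; exact hpow m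
      _ = C * r * (r * ρ) ^ m := by rw [mul_pow, pow_succ]; ring
  have hpre : IsPreconnected (Metric.ball (0 : ℝ) ρ) := (convex_ball 0 ρ).isPreconnected
  have h0 : (0 : ℝ) ∈ Metric.ball (0 : ℝ) ρ := Metric.mem_ball_self (by linarith)
  have h1 : (1 : ℝ) ∈ Metric.ball (0 : ℝ) ρ := by simpa using hρ1
  have hg0 : Summable fun m => g m 0 := by simp [g, summable_zero]
  have hsum1 : Summable fun m => g m 1 :=
    summable_of_summable_hasDerivAt_of_isPreconnected hu Metric.isOpen_ball hpre
      (fun m t _ => hg m t) hbound h0 hg0 h1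
  have hS (t : ℝ) (ht : t ∈ Metric.ball (0 : ℝ) ρ) :
      HasDerivAt S (∑' m : ℕ, t ^ m * (J ^ (m + 1)).trace) t :=
    hasDerivAt_tsum_of_isPreconnected hu Metric.isOpen_ball hpre
      (fun m t _ => hg m t) hbound h0 hg0 ht
  have hφ (t : ℝ) (ht : t ∈ Metric.ball (0 : ℝ) ρ) :
      HasDerivAt (fun s : ℝ => (1 - s • J).det)
        (-((1 - t • J).det * ∑' m : ℕ, t ^ m * (J ^ (m + 1)).trace)) t := by
    have ht' : |t| ≤ ρ := by simpa using (Metric.mem_ball.mp ht).le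
    have hnorm : ‖t • J‖ < 1 := by
      rw [norm_smul, Real.norm_eq_abs]
      nlinarith
    have hgeom : HasSum (fun m : ℕ => (t • J) ^ m) (∑' m : ℕ, (t • J) ^ m) :=
      (summable_geometric_of_norm_lt_one hnorm).hasSum
    have htrace := ((LinearMap.toContinuousLinearMap (Matrix.traceLinearMap n ℝ ℝ)).hasSum
      (hgeom.mul_right J)).tsum_eq
    have hterm : ∑' m : ℕ, t ^ m * (J ^ (m + 1)).trace
        = ((∑' m : ℕ, (t • J) ^ m) * J).trace := by
      refine Eq.trans (tsum_congr fun m => ?_) htrace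
      simp [smul_pow, pow_succ]
    rw [hterm]
    exact Matrix.hasDerivAt_det_one_sub_smul J (mul_neg_geom_series _ hnorm)
  have hconst : (1 - (1 : ℝ) • J).det * Real.exp (S 1) = (1 - (0 : ℝ) • J).det * Real.exp (S 0) := by
    refine Metric.isOpen_ball.is_const_of_deriv_eq_zero
      (f := fun t : ℝ => (1 - t • J).det * Real.exp (S t)) hpre ?_ ?_ h1 h0
    · intro t ht
      exact ((hφ t ht).mul (hS t ht).exp).differentiableAt.differentiableWithinAt
    · intro t ht
      refine ((hφ t ht).mul (hS t ht).exp).deriv.trans ?_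
      simp only [Pi.zero_apply]
      ring
  have hS0 : S 0 = 0 := by simp [S, g]
  rw [hS0] at hconst
  simp only [one_smul, zero_smul, sub_zero, det_one, Real.exp_zero, mul_one] at hconst
  have hdet : (1 - J).det = Real.exp (-S 1) := by
    rw [Real.exp_neg]; exact eq_inv_of_mul_eq_one_left hconst
  rw [hdet, Real.log_exp, neg_neg]
  simpa [S, g] using hsum1.hasSum

end LogDet

section Gaussian

variable {ι : Type*} [Fintype ι]

theorem integrable_eval_mul_eval_pi_gaussianReal (i j : ι) :
    Integrable (fun w : ι → ℝ => w i * w j) (Measure.pi fun _ : ι => gaussianReal 0 1) := by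
  have h (k : ι) : MemLp (fun w : ι → ℝ => w k) 2 (Measure.pi fun _ : ι => gaussianReal 0 1) :=
    (memLp_id_gaussianReal 2).comp_measurePreserving
      (measurePreserving_eval (fun _ : ι => gaussianReal 0 1) k)
  exact (h i).integrable_mul (h j)

theorem integral_eval_mul_eval_pi_gaussianReal [DecidableEq ι] (i j : ι) :
    ∫ w : ι → ℝ, w i * w j ∂(Measure.pi fun _ : ι => gaussianReal 0 1)
      = if i = j then 1 else 0 := by
  have hmean (k : ι) : ∫ w : ι → ℝ, w k ∂(Measure.pi fun _ : ι => gaussianReal 0 1) = 0 := by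
    rw [integral_comp_eval (μ := fun _ : ι => gaussianReal 0 1) (f := fun x : ℝ => x)
      aestronglyMeasurable_id, integral_id_gaussianReal]
  split_ifs with h
  · subst h
    rw [integral_comp_eval (μ := fun _ : ι => gaussianReal 0 1) (f := fun x : ℝ => x * x)
      (by fun_prop)]
    have hv := variance_eq_sub (memLp_id_gaussianReal (μ := 0) (v := 1) 2)
    rw [variance_id_gaussianReal] at hv
    simpa [integral_id_gaussianReal, pow_two] using hv.symm
  · have hind : iIndepFun (fun (k : ι) (w : ι → ℝ) => w k)
        (Measure.pi fun _ : ι => gaussianReal 0 1) :=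
      iIndepFun_pi (X := fun _ x => x) fun _ => aemeasurable_id
    rw [(hind.indepFun h).integral_fun_mul_eq_mul_integral
      (measurable_pi_apply i).aestronglyMeasurable (measurable_pi_apply j).aestronglyMeasurable,
      hmean, zero_mul]

theorem integrable_quadForm_pi_gaussianReal (A : Matrix ι ι ℝ) :
    Integrable (fun w : ι → ℝ => ∑ i, ∑ j, w i * A i j * w j)
      (Measure.pi fun _ : ι => gaussianReal 0 1) := by
  refine integrable_finsetSum _ fun i _ => integrable_finsetSum _ fun j _ => ?_
  refine ((integrable_eval_mul_eval_pi_gaussianReal i j).const_mul (A i j)).congr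
    (.of_forall fun w => ?_)
  ring

theorem integral_quadForm_pi_gaussianReal (A : Matrix ι ι ℝ) :
    ∫ w : ι → ℝ, ∑ i, ∑ j, w i * A i j * w j ∂(Measure.pi fun _ : ι => gaussianReal 0 1)
      = A.trace := by
  classical
  have hint (i j : ι) : Integrable (fun w : ι → ℝ => A i j * (w i * w j))
      (Measure.pi fun _ : ι => gaussianReal 0 1) :=
    (integrable_eval_mul_eval_pi_gaussianReal i j).const_mul (A i j)
  have hterm (w : ι → ℝ) (i j : ι) : w i * A i j * w j = A i j * (w i * w j) := by ring
  simp_rw [hterm]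
  rw [integral_finsetSum _ fun i _ => integrable_finsetSum _ fun j _ => hint i j]
  refine Finset.sum_congr rfl fun i _ => ?_
  rw [integral_finsetSum _ fun j _ => hint i j]
  simp_rw [integral_const_mul, integral_eval_mul_eval_pi_gaussianReal]
  simp

theorem abs_quadForm_le [DecidableEq ι] (A : Matrix ι ι ℝ) (w : ι → ℝ) :
    |∑ i, ∑ j, w i * A i j * w j| ≤ ‖Matrix.toEuclideanCLM (𝕜 := ℝ) A‖ * ∑ i, w i * w i := by
  have hquad : ∑ i, ∑ j, w i * A i j * w j
      = inner ℝ (WithLp.toLp 2 w) (Matrix.toEuclideanCLM (𝕜 := ℝ) A (WithLp.toLp 2 w)) := by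
    rw [Matrix.inner_toEuclideanCLM]
    simp [dotProduct, Matrix.mulVec, Finset.mul_sum, mul_assoc]
  have hnorm : ∑ i, w i * w i = ‖WithLp.toLp 2 w‖ * ‖WithLp.toLp 2 w‖ := by
    rw [← pow_two, EuclideanSpace.real_norm_sq_eq]
    simp [pow_two]
  rw [hquad, hnorm]
  calc _ ≤ ‖WithLp.toLp 2 w‖ * ‖Matrix.toEuclideanCLM (𝕜 := ℝ) A (WithLp.toLp 2 w)‖ :=
        abs_real_inner_le_norm _ _
    _ ≤ ‖WithLp.toLp 2 w‖ * (‖Matrix.toEuclideanCLM (𝕜 := ℝ) A‖ * ‖WithLp.toLp 2 w‖) := by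
        gcongr
        exact ContinuousLinearMap.le_opNorm _ _
    _ = _ := by ring

theorem integral_abs_quadForm_pi_gaussianReal_le [DecidableEq ι] (A : Matrix ι ι ℝ) :
    ∫ w : ι → ℝ, |∑ i, ∑ j, w i * A i j * w j| ∂(Measure.pi fun _ : ι => gaussianReal 0 1)
      ≤ ‖Matrix.toEuclideanCLM (𝕜 := ℝ) A‖ * Fintype.card ι := by
  have hint (i : ι) := integrable_eval_mul_eval_pi_gaussianReal i i
  calc _ ≤ ∫ w : ι → ℝ, ‖Matrix.toEuclideanCLM (𝕜 := ℝ) A‖ * ∑ i, w i * w i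
        ∂(Measure.pi fun _ : ι => gaussianReal 0 1) :=
        integral_mono (integrable_quadForm_pi_gaussianReal A).abs
          ((integrable_finsetSum _ fun i _ => hint i).const_mul _) (abs_quadForm_le A)
    _ = _ := by
        rw [integral_const_mul, integral_finsetSum _ fun i _ => hint i]
        simp [integral_eval_mul_eval_pi_gaussianReal]

end Gaussian

/-- **combined unbiased log-determinant estimator.** Let `J` be a real `d × d`
matrix with Euclidean operator norm `‖J‖ < 1`. Let `w` have independent standard Gaussian
coordinates and `N` be an independent ℕ-valued random variable with law `ν` satisfying
`P(N ≥ m) > 0` for all `m ≥ 1`. Then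
`E[ ∑_{m=1}^N (wᵀ Jᵐ w) / (m · P(N ≥ m)) ] = - log det (I - J)`, the expectation being with
respect to the product of the law of `N` and the product Gaussian measure. -/
theorem log_det_estimator_unbiased (d : ℕ) (J : Matrix (Fin d) (Fin d) ℝ)
    (hJ : ‖Matrix.toEuclideanCLM (𝕜 := ℝ) J‖ < 1)
    (ν : Measure ℕ) [IsProbabilityMeasure ν]
    (hν : ∀ m : ℕ, 1 ≤ m → 0 < (ν {n | m ≤ n}).toReal) :
    ∫ p : ℕ × (Fin d → ℝ),
        (∑ m ∈ Finset.Icc 1 p.1,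
          (∑ i : Fin d, ∑ j : Fin d, p.2 i * (J ^ m) i j * p.2 j)
            / ((m : ℝ) * (ν {n | m ≤ n}).toReal))
        ∂(ν.prod (Measure.pi fun _ : Fin d => ProbabilityTheory.gaussianReal 0 1))
      = - Real.log ((1 : Matrix (Fin d) (Fin d) ℝ) - J).det := by
  set γ : Measure (Fin d → ℝ) := Measure.pi fun _ : Fin d => gaussianReal 0 1 with hγ
  let q : ℕ → (Fin d → ℝ) → ℝ := fun m w => ∑ i, ∑ j, w i * (J ^ m) i j * w j
  let c : ℕ → ℝ := fun m => (m : ℝ) * (ν {n | m ≤ n}).toReal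
  let a : ℕ → ℕ → ℝ := fun m => {n | m ≤ n}.indicator fun _ => (c m)⁻¹
  let F : ℕ → ℕ × (Fin d → ℝ) → ℝ := fun m p => a (m + 1) p.1 * q (m + 1) p.2
  have hsum (p : ℕ × (Fin d → ℝ)) :
      ∑ m ∈ Finset.Icc 1 p.1, q m p.2 / c m = ∑' m, F m p := by
    rw [tsum_eq_sum (s := Finset.range p.1), ← Finset.Ico_add_one_right_eq_Icc,
      Finset.sum_Ico_eq_sum_range]
    · refine Finset.sum_congr rfl fun m hm => ?_
      have hm' : m < p.1 := by simpa using hm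
      simp [F, a, hm', add_comm 1 m, div_eq_inv_mul]
    · intro m hm
      have hm' : ¬ m < p.1 := by simpa using hm
      simp [F, a, hm']
  have ha_int (m : ℕ) : Integrable (a m) ν :=
    (integrable_const _).indicator (MeasurableSet.of_discrete)
  have hq_int (m : ℕ) : Integrable (q m) γ := integrable_quadForm_pi_gaussianReal _
  have ha (m : ℕ) : ∫ n, a (m + 1) n ∂ν = ((m : ℝ) + 1)⁻¹ := by
    have hpos := (hν (m + 1) (by omega)).ne'
    rw [integral_indicator_const _ MeasurableSet.of_discrete, smul_eq_mul, measureReal_def]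
    simp only [c]
    push_cast
    field_simp
  have ha_nonneg (m n : ℕ) : 0 ≤ a m n :=
    Set.indicator_nonneg (fun _ _ => by positivity) n
  have hF_int (m : ℕ) : Integrable (F m) (ν.prod γ) := (ha_int _).mul_prod (hq_int _)
  have hF (m : ℕ) : ∫ p, F m p ∂(ν.prod γ) = (J ^ (m + 1)).trace / ((m : ℝ) + 1) := by
    rw [integral_prod_mul, ha, integral_quadForm_pi_gaussianReal, div_eq_inv_mul]
  have hF_norm (m : ℕ) :
      ∫ p, ‖F m p‖ ∂(ν.prod γ) ≤ ‖Matrix.toEuclideanCLM (𝕜 := ℝ) J‖ ^ (m + 1) * d := by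
    have hnorm (p : ℕ × (Fin d → ℝ)) : ‖F m p‖ = a (m + 1) p.1 * |q (m + 1) p.2| := by
      rw [norm_mul, Real.norm_of_nonneg (ha_nonneg _ _), Real.norm_eq_abs]
    simp_rw [hnorm]
    rw [integral_prod_mul (f := a (m + 1)) (g := fun w => |q (m + 1) w|), ha]
    calc ((m : ℝ) + 1)⁻¹ * ∫ w, |q (m + 1) w| ∂γ ≤ 1 * ∫ w, |q (m + 1) w| ∂γ := by
          gcongr
          exact inv_le_one_of_one_le₀ (by simp)
      _ ≤ ‖Matrix.toEuclideanCLM (𝕜 := ℝ) (J ^ (m + 1))‖ * d := by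
          simpa using integral_abs_quadForm_pi_gaussianReal_le (J ^ (m + 1))
      _ ≤ _ := by
          gcongr
          rw [map_pow]
          exact norm_pow_le' _ m.succ_pos
  have hF_sum : Summable fun m => ∫ p, ‖F m p‖ ∂(ν.prod γ) :=
    Summable.of_nonneg_of_le (fun m => by positivity) hF_norm
      (((summable_nat_add_iff 1).mpr
        (summable_geometric_of_lt_one (norm_nonneg _) hJ)).mul_right _)
  calc _ = ∫ p, ∑' m, F m p ∂(ν.prod γ) := integral_congr_ae (.of_forall hsum)
    _ = ∑' m, ∫ p, F m p ∂(ν.prod γ) := (integral_tsum_of_summable_integral_norm hF_int hF_sum).symm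
    _ = _ := by
        simp_rw [hF]
        exact (Matrix.hasSum_trace_pow_div J hJ).tsum_eq
end
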